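/- Let P ⊂ ℝ² be a toric diagram having two distinct edges e and e′ whose edge vectors are parallel. Then e and e′ have the same edge vector up to sign (in particular the same length), and P admits a lattice Minkowski decomposition P = L + Q in which L is a translate of the edge e (hence a lattice segment) and Q is a lattice polytope that is not a single point. -/

import Mathlib

open Set Pointwise

noncomputable section

/-- We work in the plane `ℝ × ℝ`. -/
abbrev V : Type := ℝ × ℝ

/-- The embedding of the lattice `ℤ × ℤ` into the plane. -/
def toR (p : ℤ × ℤ) : V := ((p.1 : ℝ), (p.2 : ℝ))

/-- The set of lattice points of the plane. -/
def latticePoints : Set V := Set.range toR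

/-- A lattice polytope: the convex hull of a nonempty finite set of lattice points. -/
def IsLatticePolytope (P : Set V) : Prop :=
  ∃ S : Finset (ℤ × ℤ), S.Nonempty ∧ P = convexHull ℝ (toR '' ↑S)

/-- A toric diagram: a two-dimensional lattice polytope such that every lattice point on its
topological boundary is an extreme point. -/
def IsToricDiagram (P : Set V) : Prop :=
  IsLatticePolytope P ∧ (interior P).Nonempty ∧
    ∀ x ∈ frontier P, x ∈ latticePoints → x ∈ P.extremePoints ℝ

/-- A lattice segment: the convex hull of two distinct lattice points. -/
def IsLatticeSegment (L : Set V) : Prop :=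
  ∃ a b : ℤ × ℤ, a ≠ b ∧ L = segment ℝ (toR a) (toR b)

/-- A lattice triangle: the convex hull of three affinely independent lattice points. -/
def IsLatticeTriangle (T : Set V) : Prop :=
  ∃ a b c : ℤ × ℤ, AffineIndependent ℝ ![toR a, toR b, toR c] ∧
    T = convexHull ℝ {toR a, toR b, toR c}

/-- `E` is an edge of `P`: a maximal (nondegenerate) line segment contained in the
topological boundary of `P`. -/
def IsEdge (P E : Set V) : Prop :=
  (∃ a b : V, a ≠ b ∧ E = segment ℝ a b) ∧ E ⊆ frontier P ∧
    ∀ F : Set V, (∃ a b : V, F = segment ℝ a b) → F ⊆ frontier P → E ⊆ F → F = E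

/-- `v` is an edge vector of `P` (the difference of the endpoints of some edge of `P`). -/
def IsEdgeVector (P : Set V) (v : V) : Prop :=
  ∃ a b : V, a ≠ b ∧ IsEdge P (segment ℝ a b) ∧ v = b - a

/-- Two plane vectors are parallel when their cross product vanishes. -/
def Par (v w : V) : Prop := v.1 * w.2 = v.2 * w.1

/-- `P` admits a lattice maximal Minkowski decomposition: `P` is a Minkowski sum of at
least two lattice polytopes, each of which is a lattice segment or a lattice triangle. -/
def HasLatticeMaximalDecomposition (P : Set V) : Prop :=
  ∃ (m : ℕ) (Ps : Fin (m + 1) → Set V), 1 ≤ m ∧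
    P = ∑ k, Ps k ∧ ∀ k, IsLatticeSegment (Ps k) ∨ IsLatticeTriangle (Ps k)

/-- A convex polytope: the convex hull of a nonempty finite set of points. -/
def IsConvexPolytope (A : Set V) : Prop :=
  ∃ S : Finset V, S.Nonempty ∧ A = convexHull ℝ (↑S : Set V)

/-- `A` is a homothet `λ • P + t` (`λ > 0`) of `P`. -/
def IsHomothet (A P : Set V) : Prop :=
  ∃ (l : ℝ) (t : V), 0 < l ∧ A = (fun x => l • x + t) '' P

/-- A (nondegenerate) line segment. -/
def IsSegmentSet (A : Set V) : Prop := ∃ a b : V, a ≠ b ∧ A = segment ℝ a b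

/-- A triangle: the convex hull of three affinely independent points. -/
def IsTriangleSet (A : Set V) : Prop :=
  ∃ a b c : V, AffineIndependent ℝ ![a, b, c] ∧ A = convexHull ℝ {a, b, c}

/-- A convex polytope is Minkowski-indecomposable if in every Minkowski decomposition
into two convex polytopes, one of the summands is a point or a homothet of the polytope. -/
def MinkowskiIndecomposable (Q : Set V) : Prop :=
  ∀ A B : Set V, IsConvexPolytope A → IsConvexPolytope B → Q = A + B →
    (∃ x, A = {x}) ∨ IsHomothet A Q ∨ (∃ x, B = {x}) ∨ IsHomothet B Q

/-- A parallelogram: a quadrilateral whose vertices `v₁ v₂ v₃ v₄` in cyclic order satisfy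
`v₁ + v₃ = v₂ + v₄`. -/
def IsParallelogram (P : Set V) : Prop :=
  ∃ w : Fin 4 → V, Function.Injective w ∧ P.extremePoints ℝ = Set.range w ∧
    w 0 + w 2 = w 1 + w 3

/-- The Gauntlett–Martelli–Sparks–Waldram toric diagram `𝒴^{p,q}`. -/
def GMSW (p q : ℤ) : Set V :=
  convexHull ℝ (toR '' ({(0, 0), (1, 0), (p, p), (p - q - 1, p - q)} : Set (ℤ × ℤ)))

/-- Cross product of lattice vectors. -/
def crossZ (u w : ℤ × ℤ) : ℤ := u.1 * w.2 - u.2 * w.1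

/-- Cross product of plane vectors. -/
def crossR (u w : V) : ℝ := u.1 * w.2 - u.2 * w.1

lemma normSq_pos_of_ne {a b : V} (hab : a ≠ b) :
    0 < (b.1 - a.1) ^ 2 + (b.2 - a.2) ^ 2 := by
  rcases eq_or_ne a.1 b.1 with h1 | h1
  · have h2 : b.2 - a.2 ≠ 0 := fun h => hab (Prod.ext h1 (by linarith))
    positivity
  · have h2 : b.1 - a.1 ≠ 0 := fun h => h1 (by linarith)
    positivity

lemma mem_segment_iff_add_smul {a b x : V} :
    x ∈ segment ℝ a b ↔ ∃ s : ℝ, 0 ≤ s ∧ s ≤ 1 ∧ x = a + s • (b - a) := by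
  rw [segment_eq_image']
  constructor
  · rintro ⟨s, ⟨h0, h1⟩, rfl⟩
    exact ⟨s, h0, h1, rfl⟩
  · rintro ⟨s, h0, h1, rfl⟩
    exact ⟨s, ⟨h0, h1⟩, rfl⟩

lemma exists_eq_add_smul_of_crossR_eq_zero {a b x : V} (hab : a ≠ b)
    (h : crossR (b - a) (x - a) = 0) : ∃ s : ℝ, x = a + s • (b - a) := by
  have hN := normSq_pos_of_ne hab
  refine ⟨((x.1 - a.1) * (b.1 - a.1) + (x.2 - a.2) * (b.2 - a.2)) /
    ((b.1 - a.1) ^ 2 + (b.2 - a.2) ^ 2), ?_⟩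
  simp only [crossR, Prod.fst_sub, Prod.snd_sub] at h
  ext
  · simp only [Prod.fst_add, Prod.smul_fst, Prod.fst_sub, smul_eq_mul]
    field_simp
    linear_combination -(b.2 - a.2) * h
  · simp only [Prod.snd_add, Prod.smul_snd, Prod.snd_sub, smul_eq_mul]
    field_simp
    linear_combination (b.1 - a.1) * h

/-- A linear functional vanishing on a nonzero vector `b - a` is a multiple of `crossR (b - a)`. -/
lemma exists_eq_mul_crossR {a b : V} (hab : a ≠ b) (f : V →ₗ[ℝ] ℝ) (hf : f a = f b) :
    ∃ k : ℝ, ∀ x, f x - f a = k * crossR (b - a) (x - a) := by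
  have hN := normSq_pos_of_ne hab
  have hfx : ∀ x : V, f x = x.1 * f (1, 0) + x.2 * f (0, 1) := fun x => by
    have : x = x.1 • ((1, 0) : V) + x.2 • ((0, 1) : V) := by ext <;> simp
    conv_lhs => rw [this]
    simp only [map_add, map_smul, smul_eq_mul]
  refine ⟨((b.1 - a.1) * f (0, 1) - (b.2 - a.2) * f (1, 0)) /
    ((b.1 - a.1) ^ 2 + (b.2 - a.2) ^ 2), fun x => ?_⟩
  rw [hfx a, hfx b] at hf
  rw [hfx x, hfx a]
  simp only [crossR, Prod.fst_sub, Prod.snd_sub]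
  field_simp
  linear_combination (-(b.1 - a.1) * (x.1 - a.1) - (b.2 - a.2) * (x.2 - a.2)) * hf

/-- An edge of a planar convex body is cut out by a supporting line. -/
lemma IsEdge.exists_support {P : Set V} (hc : Convex ℝ P) (hcl : IsClosed P)
    (hi : (interior P).Nonempty) {a b : V} (hab : a ≠ b) (he : IsEdge P (segment ℝ a b)) :
    ∃ k : ℝ, k ≠ 0 ∧ (∀ x ∈ P, k * crossR (b - a) (x - a) ≤ 0) ∧
      ∀ x ∈ P, crossR (b - a) (x - a) = 0 → x ∈ segment ℝ a b := by
  obtain ⟨-, hfr, hmax⟩ := he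
  rw [hcl.frontier_eq] at hfr hmax
  set m : V := midpoint ℝ a b with hm
  have hmP := hfr (midpoint_mem_segment (𝕜 := ℝ) a b)
  have haP := (hfr (left_mem_segment ℝ a b)).1
  have hbP := (hfr (right_mem_segment ℝ a b)).1
  obtain ⟨f, hf⟩ := geometric_hahn_banach_open_point hc.interior isOpen_interior hmP.2
  have hle : ∀ x ∈ P, f x ≤ f m := by
    have hsub : closure (interior P) ⊆ {x | f x ≤ f m} :=
      closure_minimal (fun x hx => (hf x hx).le) (isClosed_le f.continuous continuous_const)
    rw [hc.closure_interior_eq_closure_of_nonempty_interior hi, hcl.closure_eq] at hsub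
    exact hsub
  have hfm : f m = (f a + f b) / 2 := by
    rw [hm, midpoint_eq_smul_add, map_smul, map_add, smul_eq_mul, invOf_eq_inv]
    ring
  have ha' := hle a haP
  have hb' := hle b hbP
  have hfab : f a = f b := by linarith
  have hfma : f m = f a := by linarith
  obtain ⟨k, hk⟩ := exists_eq_mul_crossR hab f.toLinearMap hfab
  have hk' : ∀ x, f x - f a = k * crossR (b - a) (x - a) := hk
  have hface : ∀ x ∈ P, f x = f a → ∀ y ∈ P, f y = f a → segment ℝ x y ⊆ P \ interior P := by
    intro x hx hxa y hy hya z hz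
    refine ⟨hc.segment_subset hx hy hz, fun hzi => ?_⟩
    have h1 := hf z hzi
    obtain ⟨p, q, -, -, hpq, rfl⟩ := hz
    simp only [map_add, map_smul, smul_eq_mul, hxa, hya] at h1
    rw [← add_mul, hpq, one_mul, hfma] at h1
    exact lt_irrefl _ h1
  refine ⟨k, ?_, fun x hx => ?_, fun x hx hx0 => ?_⟩
  · rintro rfl
    obtain ⟨y, hy⟩ := hi
    have h1 := hf y hy
    have h2 := hk' y
    linarith
  · rw [← hk' x]
    linarith [hle x hx]
  · have hfx : f x = f a := by
      have := hk' x
      rw [hx0] at this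
      linarith
    obtain ⟨s, hs⟩ := exists_eq_add_smul_of_crossR_eq_zero hab hx0
    rcases le_or_gt 0 s with h0 | h0
    · rcases le_or_gt s 1 with h1 | h1
      · exact mem_segment_iff_add_smul.2 ⟨s, h0, h1, hs⟩
      · rw [← hmax (segment ℝ a x) ⟨a, x, rfl⟩ (hface a haP rfl x hx hfx) ?_]
        · exact right_mem_segment ℝ a x
        · refine (convex_segment a x).segment_subset (left_mem_segment ℝ a x)
            (mem_segment_iff_add_smul.2 ⟨s⁻¹, by positivity, inv_le_one_of_one_le₀ h1.le, ?_⟩)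
          rw [hs, add_sub_cancel_left, smul_smul, inv_mul_cancel₀ (by linarith), one_smul]
          abel
    · rw [← hmax (segment ℝ x b) ⟨x, b, rfl⟩ (hface x hx hfx b hbP hfab.symm) ?_]
      · exact left_mem_segment ℝ x b
      · refine (convex_segment x b).segment_subset ?_ (right_mem_segment ℝ x b)
        have h1s : 0 < 1 - s := by linarith
        refine ⟨1 / (1 - s), -s / (1 - s), by positivity,
          div_nonneg (by linarith) h1s.le, by field_simp; ring, ?_⟩
        rw [hs]
        ext <;> simp <;> field_simp <;> ring

lemma IsEdge.left_mem_extremePoints {P : Set V} (hc : Convex ℝ P) (hcl : IsClosed P)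
    (hi : (interior P).Nonempty) {a b : V} (hab : a ≠ b) (he : IsEdge P (segment ℝ a b)) :
    a ∈ P.extremePoints ℝ := by
  obtain ⟨k, hk0, hk, hface⟩ := he.exists_support hc hcl hi hab
  have haP : a ∈ P := hcl.frontier_subset (he.2.1 (left_mem_segment ℝ a b))
  refine mem_extremePoints_iff_left.2 ⟨haP, fun x hx y hy hxy => ?_⟩
  obtain ⟨p, q, hp, hq, hpq, hxy⟩ := hxy
  have hsum : p * (k * crossR (b - a) (x - a)) + q * (k * crossR (b - a) (y - a)) = 0 := by
    have h1 : p * x.1 + q * y.1 = a.1 := by simpa using congrArg Prod.fst hxy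
    have h2 : p * x.2 + q * y.2 = a.2 := by simpa using congrArg Prod.snd hxy
    simp only [crossR, Prod.fst_sub, Prod.snd_sub]
    linear_combination k * (b.1 - a.1) * h2 - k * (b.2 - a.2) * h1
      - k * ((b.1 - a.1) * a.2 - (b.2 - a.2) * a.1) * hpq
  have hx1 := hk x hx
  have hy1 := hk y hy
  have hx2 : k * crossR (b - a) (x - a) = 0 := by nlinarith
  have hy2 : k * crossR (b - a) (y - a) = 0 := by nlinarith
  obtain ⟨s, hs0, -, rfl⟩ := mem_segment_iff_add_smul.1
    (hface x hx ((mul_eq_zero.1 hx2).resolve_left hk0))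
  obtain ⟨r, hr0, -, rfl⟩ := mem_segment_iff_add_smul.1
    (hface y hy ((mul_eq_zero.1 hy2).resolve_left hk0))
  have hsr : (p * s + q * r) • (b - a) = 0 := by
    have : p • (a + s • (b - a)) + q • (a + r • (b - a))
        = (p + q) • a + (p * s + q * r) • (b - a) := by module
    rw [this, hpq, one_smul] at hxy
    simpa using hxy
  have hz := (smul_eq_zero.1 hsr).resolve_right (sub_ne_zero.2 hab.symm)
  have : s = 0 := by nlinarith [mul_nonneg hp.le hs0, mul_nonneg hq.le hr0]
  simp [this]

lemma toR_add (p q : ℤ × ℤ) : toR (p + q) = toR p + toR q := by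
  ext <;> simp [toR]

lemma toR_sub (p q : ℤ × ℤ) : toR (p - q) = toR p - toR q := by
  ext <;> simp [toR]

lemma IsLatticePolytope.convex {P : Set V} (hP : IsLatticePolytope P) : Convex ℝ P := by
  obtain ⟨S, -, rfl⟩ := hP
  exact convex_convexHull ℝ _

lemma IsLatticePolytope.isCompact {P : Set V} (hP : IsLatticePolytope P) : IsCompact P := by
  obtain ⟨S, -, rfl⟩ := hP
  exact (S.finite_toSet.image toR).isCompact_convexHull (𝕜 := ℝ)

lemma IsLatticePolytope.extremePoints_subset {P : Set V} (hP : IsLatticePolytope P) :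
    P.extremePoints ℝ ⊆ latticePoints := by
  obtain ⟨S, -, rfl⟩ := hP
  exact extremePoints_convexHull_subset.trans (image_subset_range _ _)

/-- No lattice point lies in the relative interior of an edge of a toric diagram. -/
lemma IsToricDiagram.add_smul_notMem_latticePoints {P : Set V} (hP : IsToricDiagram P)
    {a b : V} (hab : a ≠ b) (he : IsEdge P (segment ℝ a b)) {s : ℝ} (h0 : 0 < s) (h1 : s < 1) :
    a + s • (b - a) ∉ latticePoints := by
  intro hl
  have hmem : a + s • (b - a) ∈ openSegment ℝ a b := by
    rw [openSegment_eq_image']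
    exact ⟨s, ⟨h0, h1⟩, rfl⟩
  have hsub := he.2.1.trans hP.1.isCompact.isClosed.frontier_subset
  have hx := hP.2.2 _ (he.2.1 (openSegment_subset_segment ℝ a b hmem)) hl
  have h := hx.2 (hsub (left_mem_segment ℝ a b)) (hsub (right_mem_segment ℝ a b)) hmem
  have : s • (b - a) = 0 := by simpa using h.symm
  rcases smul_eq_zero.1 this with h | h
  · exact h0.ne' h
  · exact hab (sub_eq_zero.1 h).symm

/-- Codirectional edges of a toric diagram have the same edge vector. -/
lemma IsToricDiagram.edgeVector_eq {P : Set V} (hP : IsToricDiagram P)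
    {a b c d : V} (hab : a ≠ b) (hcd : c ≠ d)
    (he : IsEdge P (segment ℝ a b)) (he' : IsEdge P (segment ℝ c d))
    {l : ℝ} (hl : 0 < l) (hdc : d - c = l • (b - a)) : b - a = d - c := by
  have hlat : ∀ {x y : V}, x ≠ y → IsEdge P (segment ℝ x y) → x ∈ latticePoints :=
    fun h h' => hP.1.extremePoints_subset
      (h'.left_mem_extremePoints hP.1.convex hP.1.isCompact.isClosed hP.2.1 h)
  obtain ⟨A, rfl⟩ := hlat hab he
  obtain ⟨B, rfl⟩ := hlat hab.symm (segment_symm ℝ (toR A) b ▸ he)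
  obtain ⟨C, rfl⟩ := hlat hcd he'
  obtain ⟨D, rfl⟩ := hlat hcd.symm (segment_symm ℝ (toR C) d ▸ he')
  rcases lt_trichotomy l 1 with h | h | h
  · refine absurd ?_ (hP.add_smul_notMem_latticePoints hab he hl h)
    rw [← hdc, ← toR_sub, ← toR_add]
    exact mem_range_self _
  · rw [hdc, h, one_smul]
  · refine absurd ?_ (hP.add_smul_notMem_latticePoints hcd he' (inv_pos.2 hl)
      (inv_lt_one_of_one_lt₀ h))
    rw [hdc, smul_smul, inv_mul_cancel₀ hl.ne', one_smul, ← toR_sub, ← toR_add]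
    exact mem_range_self _

/-- A toric diagram lies in the strip spanned by two distinct codirectional edges. -/
lemma IsToricDiagram.exists_strip_coordinates {P : Set V} (hP : IsToricDiagram P)
    {a b c d : V} (hab : a ≠ b) (hcd : c ≠ d)
    (he : IsEdge P (segment ℝ a b)) (he' : IsEdge P (segment ℝ c d))
    (hne : segment ℝ a b ≠ segment ℝ c d) (hdc : b - a = d - c) {x : V} (hx : x ∈ P) :
    ∃ t s : ℝ, 0 ≤ t ∧ t ≤ 1 ∧ x = (1 - t) • a + t • c + s • (b - a) := by
  have hcl := hP.1.isCompact.isClosed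
  obtain ⟨k, hk0, hk, hf⟩ := he.exists_support hP.1.convex hcl hP.2.1 hab
  obtain ⟨k', hk0', hk', hf'⟩ := he'.exists_support hP.1.convex hcl hP.2.1 hcd
  have hsub := he.2.1.trans hcl.frontier_subset
  have hsub' := he'.2.1.trans hcl.frontier_subset
  have haP := hsub (left_mem_segment ℝ a b)
  have hbP := hsub (right_mem_segment ℝ a b)
  have hcP := hsub' (left_mem_segment ℝ c d)
  have hdP := hsub' (right_mem_segment ℝ c d)
  rw [← hdc] at hk' hf'
  have hd : d = c + (b - a) := by rw [hdc]; abel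
  have hcross : ∀ y z w : V, crossR (b - a) (y - w)
      = crossR (b - a) (y - z) + crossR (b - a) (z - w) := by
    intro y z w
    simp only [crossR, Prod.fst_sub, Prod.snd_sub]
    ring
  have hba : crossR (b - a) (b - a) = 0 := by simp only [crossR]; ring
  have hdc0 : crossR (b - a) (d - c) = 0 := by rw [← hdc]; exact hba
  have hac : crossR (b - a) (a - c) = - crossR (b - a) (c - a) := by
    simp only [crossR, Prod.fst_sub, Prod.snd_sub]
    ring
  have hD : crossR (b - a) (c - a) ≠ 0 := by
    intro hD
    apply hne
    apply Subset.antisymm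
    · refine (convex_segment c d).segment_subset (hf' a haP ?_) (hf' b hbP ?_)
      · rw [hac, hD, neg_zero]
      · rw [hcross b a c, hac, hD, hba]; ring
    · refine (convex_segment a b).segment_subset (hf c hcP hD) (hf d hdP ?_)
      rw [hcross d c a, hdc0, hD]; ring
  set D := crossR (b - a) (c - a) with hDdef
  have h1 := hk c hcP
  have h2 := hk' a haP
  have h3 := hk x hx
  have h4 := hk' x hx
  rw [hac] at h2
  have hxc : crossR (b - a) (x - c) = crossR (b - a) (x - a) - D := by
    rw [hcross x a c, hac]; ring
  rw [hxc] at h4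
  set X := crossR (b - a) (x - a) with hX
  have hbounds : 0 ≤ X / D ∧ X / D ≤ 1 := by
    rcases lt_or_gt_of_ne hD with hneg | hpos
    · have hkp : 0 < k := lt_of_le_of_ne (by nlinarith) hk0.symm
      have hkn : k' < 0 := lt_of_le_of_ne (by nlinarith) hk0'
      refine ⟨div_nonneg_of_nonpos (by nlinarith) hneg.le, ?_⟩
      rw [div_le_one_of_neg hneg]
      nlinarith
    · have hkn : k < 0 := lt_of_le_of_ne (by nlinarith) hk0
      have hkp : 0 < k' := lt_of_le_of_ne (by nlinarith) hk0'.symm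
      refine ⟨div_nonneg (by nlinarith) hpos.le, ?_⟩
      rw [div_le_one hpos]
      nlinarith
  have h0 : crossR (b - a) ((x - (X / D) • (c - a)) - a) = 0 := by
    have : crossR (b - a) ((x - (X / D) • (c - a)) - a) = X - X / D * D := by
      simp only [hX, hDdef, crossR, Prod.fst_sub, Prod.snd_sub, Prod.smul_fst, Prod.smul_snd,
        smul_eq_mul]
      ring
    rw [this, div_mul_cancel₀ _ hD, sub_self]
  obtain ⟨s, hs⟩ := exists_eq_add_smul_of_crossR_eq_zero hab h0
  refine ⟨X / D, s, hbounds.1, hbounds.2, ?_⟩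
  rw [sub_eq_iff_eq_add] at hs
  rw [hs]
  module

/-- Every extreme point of a toric diagram can be translated, inside the diagram, along the common
edge vector of two distinct codirectional edges, in one of the two directions. -/
lemma IsToricDiagram.add_mem_or_sub_mem {P : Set V} (hP : IsToricDiagram P)
    {a b c d : V} (hab : a ≠ b) (hcd : c ≠ d)
    (he : IsEdge P (segment ℝ a b)) (he' : IsEdge P (segment ℝ c d))
    (hne : segment ℝ a b ≠ segment ℝ c d) (hdc : b - a = d - c) {x : V}
    (hx : x ∈ P.extremePoints ℝ) : x + (b - a) ∈ P ∨ x - (b - a) ∈ P := by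
  obtain ⟨t, s, ht0, ht1, hxt⟩ :=
    hP.exists_strip_coordinates hab hcd he he' hne hdc (extremePoints_subset hx)
  have hcl := hP.1.isCompact.isClosed
  have hsub := he.2.1.trans hcl.frontier_subset
  have hsub' := he'.2.1.trans hcl.frontier_subset
  set p := (1 - t) • a + t • c with hp
  have hpP : p ∈ P := hP.1.convex (hsub (left_mem_segment ℝ a b))
    (hsub' (left_mem_segment ℝ c d)) (by linarith) ht0 (by ring)
  have hqP : p + (b - a) ∈ P := by
    have : p + (b - a) = (1 - t) • b + t • d := by
      have hd : d = c + (b - a) := by rw [hdc]; abel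
      rw [hd, hp]
      module
    rw [this]
    exact hP.1.convex (hsub (right_mem_segment ℝ a b))
      (hsub' (right_mem_segment ℝ c d)) (by linarith) ht0 (by ring)
  have hxP := extremePoints_subset hx
  have hline : ∀ {r r' q : ℝ}, p + r • (b - a) ∈ P → p + r' • (b - a) ∈ P → r ≤ q → q ≤ r' →
      p + q • (b - a) ∈ P := by
    intro r r' q hr hr' h1 h2
    rcases eq_or_lt_of_le (h1.trans h2) with h | h
    · rwa [show q = r by linarith]
    · have h' : 0 < r' - r := by linarith
      have := hP.1.convex hr hr' (div_nonneg (sub_nonneg.2 h2) h'.le)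
        (div_nonneg (sub_nonneg.2 h1) h'.le) (by field_simp; ring)
      convert this using 1
      ext <;> simp <;> field_simp <;> ring
  have hp0 : p + (0 : ℝ) • (b - a) ∈ P := by simpa using hpP
  have hp1 : p + (1 : ℝ) • (b - a) ∈ P := by simpa using hqP
  rcases le_or_gt s 0 with h0 | h0
  · left
    have := hline (q := s + 1) (hxt ▸ hxP) hp1 (by linarith) (by linarith)
    convert this using 1
    rw [hxt]
    module
  · rcases le_or_gt 1 s with h1 | h1
    · right
      have := hline (q := s - 1) hp0 (hxt ▸ hxP) (by linarith) (by linarith)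
      convert this using 1
      rw [hxt]
      module
    · have hmem : x ∈ openSegment ℝ p (p + (b - a)) := by
        rw [openSegment_eq_image']
        exact ⟨s, ⟨h0, h1⟩, by rw [hxt, add_sub_cancel_left]⟩
      left
      rw [← hx.2 hpP hqP hmem]
      exact hqP

/-- The Minkowski decomposition splitting off the edge vector of two distinct codirectional
edges. -/
lemma IsToricDiagram.exists_decomposition {P : Set V} (hP : IsToricDiagram P)
    {a b c d : V} (hab : a ≠ b) (hcd : c ≠ d)
    (he : IsEdge P (segment ℝ a b)) (he' : IsEdge P (segment ℝ c d))
    (hne : segment ℝ a b ≠ segment ℝ c d) (hdc : b - a = d - c) :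
    ∃ (t : V) (Q : Set V),
      IsLatticeSegment (t +ᵥ segment ℝ a b) ∧
      IsLatticePolytope Q ∧ (¬ ∃ x, Q = {x}) ∧
      P = (t +ᵥ segment ℝ a b) + Q := by
  classical
  have hcomp := hP.1.isCompact
  have hconv := hP.1.convex
  have hcl := hcomp.isClosed
  have hsub' := he'.2.1.trans hcl.frontier_subset
  have haE := he.left_mem_extremePoints hconv hcl hP.2.1 hab
  have hcE := he'.left_mem_extremePoints hconv hcl hP.2.1 hcd
  have hbE : b ∈ P.extremePoints ℝ :=
    IsEdge.left_mem_extremePoints hconv hcl hP.2.1 hab.symm (segment_symm ℝ a b ▸ he)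
  have hshift := fun x (hx : x ∈ P.extremePoints ℝ) =>
    hP.add_mem_or_sub_mem hab hcd he he' hne hdc hx
  obtain ⟨S, -, hS⟩ := hP.1
  have hES : P.extremePoints ℝ ⊆ toR '' ↑S := by
    rw [hS]
    exact extremePoints_convexHull_subset
  obtain ⟨A, hA, rfl⟩ := hES haE
  obtain ⟨B, hB, rfl⟩ := hES hbE
  have hvadd : (-toR A) +ᵥ segment ℝ (toR A) (toR B)
      = segment ℝ (toR 0) (toR (B - A)) := by
    have h0 : toR 0 = -toR A + toR A := by ext <;> simp [toR]
    have h1 : toR (B - A) = -toR A + toR B := by rw [toR_sub]; abel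
    rw [h0, h1, ← segment_translate_image ℝ (-toR A)]
    rfl
  set u := toR B - toR A with hu
  have hseg : segment ℝ (toR 0) (toR (B - A)) = segment ℝ 0 u := by
    rw [toR_sub, show toR 0 = 0 by ext <;> simp [toR]]
  set T : Finset (ℤ × ℤ) :=
    (S ∪ S.image (· - (B - A))).filter (fun x => toR x ∈ P ∧ toR x + u ∈ P) with hT
  have hcT : c ∈ toR '' (T : Set (ℤ × ℤ)) := by
    obtain ⟨C, hC, rfl⟩ := hES hcE
    refine ⟨C, ?_, rfl⟩
    simp only [hT, Finset.coe_filter, Finset.mem_union, mem_ofPred_eq]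
    refine ⟨Or.inl hC, hcE.1, ?_⟩
    rw [hdc, add_sub_cancel]
    exact hsub' (right_mem_segment ℝ _ _)
  have haT : toR A ∈ toR '' (T : Set (ℤ × ℤ)) := by
    refine ⟨A, ?_, rfl⟩
    simp only [hT, Finset.coe_filter, Finset.mem_union, mem_ofPred_eq]
    refine ⟨Or.inl hA, haE.1, ?_⟩
    rw [hu, add_sub_cancel]
    exact hbE.1
  have hTne : T.Nonempty := by
    obtain ⟨x, hx, -⟩ := haT
    exact ⟨x, hx⟩
  refine ⟨-toR A, convexHull ℝ (toR '' (T : Set (ℤ × ℤ))), ?_, ⟨T, hTne, rfl⟩, ?_, ?_⟩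
  · refine ⟨0, B - A, fun h => hab ?_, hvadd⟩
    rw [sub_eq_zero.1 h.symm]
  · rintro ⟨x, hx⟩
    have h1 : toR A = x := hx.subset (subset_convexHull ℝ _ haT)
    have h2 : c = x := hx.subset (subset_convexHull ℝ _ hcT)
    apply hne
    have h3 : c = toR A := h2.trans h1.symm
    have h4 : d = toR B := by
      rw [h3, hu] at hdc
      exact (sub_left_injective hdc).symm
    rw [h3, h4]
  · rw [hvadd, hseg]
    apply Subset.antisymm
    · have hcompQ : IsCompact (segment ℝ 0 u + convexHull ℝ (toR '' (T : Set (ℤ × ℤ)))) := by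
        refine IsCompact.add ?_ ((T.finite_toSet.image toR).isCompact_convexHull (𝕜 := ℝ))
        rw [← convexHull_pair]
        exact (toFinite _).isCompact_convexHull (𝕜 := ℝ)
      rw [← closure_convexHull_extremePoints hcomp hconv]
      refine closure_minimal (convexHull_min (fun x hx => ?_)
        ((convex_segment 0 u).add (convex_convexHull ℝ _))) hcompQ.isClosed
      obtain ⟨X, hX, rfl⟩ := hES hx
      rcases hshift _ hx with h | h
      · refine ⟨0, left_mem_segment ℝ 0 u, toR X, subset_convexHull ℝ _ ⟨X, ?_, rfl⟩, zero_add _⟩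
        simp only [hT, Finset.coe_filter, Finset.mem_union, mem_ofPred_eq]
        exact ⟨Or.inl hX, hx.1, h⟩
      · have hXu : toR (X - (B - A)) = toR X - u := by rw [toR_sub, toR_sub]
        refine ⟨u, right_mem_segment ℝ 0 u, toR X - u,
          subset_convexHull ℝ _ ⟨X - (B - A), ?_, hXu⟩, add_sub_cancel _ _⟩
        simp only [hT, Finset.coe_filter, Finset.mem_union, mem_ofPred_eq]
        refine ⟨Or.inr (Finset.mem_image_of_mem _ hX), ?_, ?_⟩
        · rw [hXu]
          exact h
        · rw [hXu, sub_add_cancel]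
          exact hx.1
    · rintro _ ⟨y, hy, q, hq, rfl⟩
      have hsubQ : convexHull ℝ (toR '' (T : Set (ℤ × ℤ))) ⊆ P ∩ (fun x => x + u) ⁻¹' P := by
        refine convexHull_min ?_ (hconv.inter (hconv.translate_preimage_left u))
        rintro _ ⟨x, hx, rfl⟩
        exact (Finset.mem_filter.1 hx).2
      obtain ⟨h1, h2⟩ := hsubQ hq
      obtain ⟨s, hs0, hs1, rfl⟩ := mem_segment_iff_add_smul.1 hy
      have h3 := hconv h1 h2 (sub_nonneg.2 hs1) hs0 (by ring)
      convert h3 using 1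
      dsimp only
      module

/-- If a toric diagram `P` has two distinct edges `e = [a,b]` and
`e' = [c,d]` with parallel edge vectors, then the edge vectors agree up to sign, and `P`
admits a lattice Minkowski decomposition `P = L + Q` with `L` a translate of `e` (hence a
lattice segment) and `Q` a lattice polytope that is not a single point. -/
theorem statement2 (P : Set V) (hP : IsToricDiagram P)
    (a b c d : V) (hab : a ≠ b) (hcd : c ≠ d)
    (he : IsEdge P (segment ℝ a b)) (he' : IsEdge P (segment ℝ c d))
    (hne : segment ℝ a b ≠ segment ℝ c d)
    (hpar : Par (b - a) (d - c)) :
    (b - a = d - c ∨ b - a = -(d - c)) ∧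
    ∃ (t : V) (Q : Set V),
      IsLatticeSegment (t +ᵥ segment ℝ a b) ∧
      IsLatticePolytope Q ∧ (¬ ∃ x, Q = {x}) ∧
      P = (t +ᵥ segment ℝ a b) + Q := by
  obtain ⟨l, hl⟩ : ∃ l : ℝ, d - c = l • (b - a) := by
    have h0 : crossR (b - a) ((a + (d - c)) - a) = 0 := by
      rw [add_sub_cancel_left]
      exact sub_eq_zero.2 hpar
    obtain ⟨l, hl⟩ := exists_eq_add_smul_of_crossR_eq_zero hab h0
    exact ⟨l, add_left_cancel hl⟩
  rcases lt_trichotomy l 0 with h | rfl | h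
  · rw [segment_symm ℝ c d] at he' hne
    have heq := hP.edgeVector_eq hab hcd.symm he he' (neg_pos.2 h)
      (by rw [neg_smul, ← hl, neg_sub])
    exact ⟨Or.inr (by rw [heq, neg_sub]),
      hP.exists_decomposition hab hcd.symm he he' hne heq⟩
  · rw [zero_smul, sub_eq_zero] at hl
    exact absurd hl.symm hcd
  · have heq := hP.edgeVector_eq hab hcd he he' h hl
    exact ⟨Or.inl heq, hP.exists_decomposition hab hcd he he' hne heq⟩
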